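/- Let f: (0,1) → ℝ be radial data with f ≥ 0 and f ∈ L²_{r^{d−1}}(0,1), and let u be the minimizer of the weighted ROF problem with weights ρ(r) = φ(r) = r^{d−1}. If lim_{r→0} r^β f(r) = +∞ for some β > 1, then u is unbounded on every neighborhood of 0 but bounded on every compact interval excluding zero. Conversely, if lim_{r→0} r^β f(r) = 0 for some β < 1, then u is bounded. -/

import Mathlib

open MeasureTheory Set Filter Topology
open scoped ENNReal NNReal

noncomputable section

/-- The weighted total variation `TV_ρ` on `(0,1)`:
`TV_ρ(u) = sup {∫ u z' : z ∈ C¹_c(0,1), |z| ≤ ρ}`. -/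
def TVw (ρ : ℝ → ℝ) (u : ℝ → ℝ) : EReal :=
  sSup ((fun z => ((∫ x in Set.Ioo (0:ℝ) 1, u x * deriv z x : ℝ) : EReal)) ''
    {z : ℝ → ℝ | ContDiff ℝ 1 z ∧ HasCompactSupport z ∧ tsupport z ⊆ Set.Ioo 0 1 ∧
      ∀ x ∈ Set.Ioo (0:ℝ) 1, |z x| ≤ ρ x})

/-- Membership in the weighted Lebesgue space `L²_φ(0,1)`. -/
def MemL2w (φ u : ℝ → ℝ) : Prop :=
  AEMeasurable u (volume.restrict (Set.Ioo (0:ℝ) 1)) ∧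
  IntegrableOn (fun x => u x ^ 2 * φ x) (Set.Ioo (0:ℝ) 1)

/-- Objective of the weighted ROF (denoising) problem `∫ (u-f)² φ + α TV_ρ(u)`. -/
def EROF (φ ρ f : ℝ → ℝ) (α : ℝ) (u : ℝ → ℝ) : EReal :=
  ((∫ x in Set.Ioo (0:ℝ) 1, (u x - f x) ^ 2 * φ x : ℝ) : EReal) + (α : EReal) * TVw ρ u

/-- `u₀` is a minimizer of the weighted ROF problem over `L²_φ(0,1)`. -/
def IsEROFMinimizer (φ ρ f : ℝ → ℝ) (α : ℝ) (u₀ : ℝ → ℝ) : Prop :=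
  MemL2w φ u₀ ∧ ∀ u, MemL2w φ u → EROF φ ρ f α u₀ ≤ EROF φ ρ f α u

/-- Standing assumptions on the weights `φ, ρ` on `(0,1)`: positivity, `ρ` Lipschitz,
`φ` continuous and bounded, `1/φ` locally bounded in `(0,1)`. -/
structure WeightsOK (φ ρ : ℝ → ℝ) : Prop where
  φ_pos : ∀ x ∈ Set.Ioo (0:ℝ) 1, 0 < φ x
  ρ_pos : ∀ x ∈ Set.Ioo (0:ℝ) 1, 0 < ρ x
  ρ_lip : ∃ L : ℝ≥0, LipschitzOnWith L ρ (Set.Ioo (0:ℝ) 1)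
  φ_cont : ContinuousOn φ (Set.Ioo (0:ℝ) 1)
  φ_bdd : ∃ M : ℝ, ∀ x ∈ Set.Ioo (0:ℝ) 1, φ x ≤ M
  inv_φ_loc : ∀ K : Set ℝ, K ⊆ Set.Ioo (0:ℝ) 1 → IsCompact K →
    ∃ c : ℝ, ∀ x ∈ K, 1 / φ x ≤ c

/-- `g` is the derivative of `U` in the sense that `U` is the integral of `g`, with
`g ∈ L²_{1/φ}(0,1)`; this realizes `U ∈ W^{1,2}_{1,1/φ}(0,1)` (continuous
representative). -/
def RepDeriv (φ U g : ℝ → ℝ) : Prop :=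
  IntegrableOn g (Set.Ioo (0:ℝ) 1) ∧
  IntegrableOn (fun x => g x ^ 2 / φ x) (Set.Ioo (0:ℝ) 1) ∧
  ∀ x ∈ Set.Icc (0:ℝ) 1, U x = U 0 + ∫ t in Set.Ioc (0:ℝ) x, g t

/-- Membership in the weighted Sobolev space `W^{1,2}_{1,1/φ}(0,1)`. -/
def MemW (φ U : ℝ → ℝ) : Prop :=
  IntegrableOn (fun x => U x ^ 2) (Set.Ioo (0:ℝ) 1) ∧ ∃ g, RepDeriv φ U g

/-- Admissible test functions for `TVw` with the weight `x ↦ x ^ n`. -/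
def IsTest (n : ℕ) (z : ℝ → ℝ) : Prop :=
  ContDiff ℝ 1 z ∧ HasCompactSupport z ∧ tsupport z ⊆ Ioo 0 1 ∧
    ∀ x ∈ Ioo (0 : ℝ) 1, |z x| ≤ x ^ n

/-- `T` bounds the weighted total variation of `u` from above. -/
def TVBound (n : ℕ) (u : ℝ → ℝ) (T : ℝ) : Prop :=
  ∀ z, IsTest n z → ∫ x in Ioo (0 : ℝ) 1, u x * deriv z x ≤ T

lemma isTest_zero (n : ℕ) : IsTest n 0 := by
  refine ⟨contDiff_const, HasCompactSupport.zero, ?_, fun x hx => ?_⟩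
  · simp [tsupport]
  · simpa using pow_nonneg hx.1.le n

lemma memL2w_zero (φ : ℝ → ℝ) : MemL2w φ 0 := by
  refine ⟨aemeasurable_const, ?_⟩
  simp

lemma TVw_le_iff {n : ℕ} {u : ℝ → ℝ} {S : ℝ} :
    TVw (fun r => r ^ n) u ≤ (S : EReal) ↔ TVBound n u S := by
  unfold TVw TVBound IsTest
  rw [sSup_le_iff]
  simp only [mem_image, mem_ofPred_eq, forall_exists_index, and_imp]
  constructor
  · intro h z h1 h2 h3 h4
    exact EReal.coe_le_coe_iff.1 (h _ z h1 h2 h3 h4 rfl)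
  · rintro h _ z h1 h2 h3 h4 rfl
    exact EReal.coe_le_coe_iff.2 (h z h1 h2 h3 h4)

lemma IsEROFMinimizer.exists_real {n : ℕ} {f u : ℝ → ℝ} {α : ℝ} (hα : 0 < α)
    (hu : IsEROFMinimizer (fun r => r ^ n) (fun r => r ^ n) f α u) :
    ∃ T, TVBound n u T ∧ ∀ v S, MemL2w (fun r => r ^ n) v → TVBound n v S →
      (∫ x in Ioo (0 : ℝ) 1, (u x - f x) ^ 2 * x ^ n) + α * T ≤
        (∫ x in Ioo (0 : ℝ) 1, (v x - f x) ^ 2 * x ^ n) + α * S := by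
  have key : ∀ v S, MemL2w (fun r => r ^ n) v → TVBound n v S →
      EROF (fun r => r ^ n) (fun r => r ^ n) f α u ≤
        (((∫ x in Ioo (0 : ℝ) 1, (v x - f x) ^ 2 * x ^ n) + α * S : ℝ) : EReal) := by
    intro v S hv hS
    refine (hu.2 v hv).trans ?_
    unfold EROF
    rw [EReal.coe_add, EReal.coe_mul]
    gcongr
    exact TVw_le_iff.2 hS
  have h0 : (0 : EReal) ≤ TVw (fun r => r ^ n) u := by
    refine le_sSup ⟨0, isTest_zero n, ?_⟩
    simp
  have htop : TVw (fun r => r ^ n) u ≠ ⊤ := by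
    intro h
    have := key 0 0 (memL2w_zero _) (fun z _ => by simp)
    unfold EROF at this
    rw [h, EReal.coe_mul_top_of_pos hα, EReal.coe_add_top, top_le_iff] at this
    exact EReal.coe_ne_top _ this
  have hbot : TVw (fun r => r ^ n) u ≠ ⊥ := fun h => by simp [h] at h0
  have hT := EReal.coe_toReal htop hbot
  refine ⟨(TVw (fun r => r ^ n) u).toReal, TVw_le_iff.1 hT.ge, fun v S hv hS => ?_⟩
  have := key v S hv hS
  unfold EROF at this
  rw [← hT] at this
  exact_mod_cast this

lemma IsCompact.exists_Icc_of_subset_Ioo {K : Set ℝ} (hK : IsCompact K)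
    (h : K ⊆ Ioo (0 : ℝ) 1) : ∃ a b, 0 < a ∧ a ≤ b ∧ b < 1 ∧ K ⊆ Icc a b := by
  rcases K.eq_empty_or_nonempty with rfl | hne
  · exact ⟨1 / 2, 1 / 2, by norm_num, le_rfl, by norm_num, empty_subset _⟩
  · obtain ⟨a, ha⟩ := hK.exists_isLeast hne
    obtain ⟨b, hb⟩ := hK.exists_isGreatest hne
    exact ⟨a, b, (h ha.1).1, ha.2 hb.1, (h hb.1).2, fun x hx => ⟨ha.2 hx, hb.2 hx⟩⟩

lemma MemL2w.integrableOn_Ioo {n : ℕ} {u : ℝ → ℝ} (hu : MemL2w (fun r => r ^ n) u)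
    {δ : ℝ} (hδ : 0 < δ) : IntegrableOn u (Ioo δ 1) := by
  have hsub : Ioo δ 1 ⊆ Ioo (0 : ℝ) 1 := Ioo_subset_Ioo_left hδ.le
  have hi : IntegrableOn (fun x => 1 + u x ^ 2 * x ^ n / δ ^ n) (Ioo δ 1) :=
    (integrableOn_const (by simp)).add ((hu.2.mono_set hsub).div_const _)
  refine hi.mono' (hu.1.mono_measure (Measure.restrict_mono hsub le_rfl)).aestronglyMeasurable ?_
  filter_upwards [ae_restrict_mem measurableSet_Ioo] with x hx
  have h1 : δ ^ n ≤ x ^ n := pow_le_pow_left₀ hδ.le hx.1.le n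
  have h2 : u x ^ 2 ≤ u x ^ 2 * x ^ n / δ ^ n := by
    rw [le_div_iff₀ (pow_pos hδ n)]
    gcongr
  rw [Real.norm_eq_abs]
  nlinarith [sq_abs (u x), sq_nonneg (|u x| - 1)]

/-- Pairing with a mean-zero continuous function whose primitive is admissible. -/
lemma TVBound.integral_mul_le {n : ℕ} {u k : ℝ → ℝ} {T a b : ℝ} (hT : TVBound n u T)
    (hk : Continuous k) (ha : 0 < a) (hb : b < 1)
    (hsupp : ∀ x ∉ Icc a b, k x = 0) (hmean : ∫ x in (0 : ℝ)..1, k x = 0)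
    (hbd : ∀ x ∈ Ioo (0 : ℝ) 1, |∫ t in (0 : ℝ)..x, k t| ≤ x ^ n) :
    ∫ x in Ioo (0 : ℝ) 1, u x * k x ≤ T := by
  set z : ℝ → ℝ := fun x => ∫ t in (0 : ℝ)..x, k t with hz
  have hd : ∀ x, HasDerivAt z (k x) x := fun x =>
    intervalIntegral.integral_hasDerivAt_right (hk.intervalIntegrable _ _)
      (hk.stronglyMeasurableAtFilter _ _) hk.continuousAt
  have hderiv : deriv z = k := funext fun x => (hd x).deriv
  have hz0 : ∀ x ∉ Icc a b, z x = 0 := by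
    intro x hx
    rw [mem_Icc, not_and_or, not_le, not_le] at hx
    rcases hx with hx | hx
    · refine (intervalIntegral.integral_congr (g := fun _ => 0) fun t ht => ?_).trans (by simp)
      refine hsupp t fun h => ?_
      have := ht.2
      have := h.1
      have : max 0 x < a := max_lt ha hx
      linarith
    · have h1 : ∫ t in x..1, k t = 0 := by
        refine (intervalIntegral.integral_congr (g := fun _ => 0) fun t ht => ?_).trans (by simp)
        refine hsupp t fun h => ?_
        have := ht.1
        have := h.2
        have : b < min x 1 := lt_min hx hb
        linarith
      have h2 := intervalIntegral.integral_add_adjacent_intervals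
        (hk.intervalIntegrable (μ := volume) 0 x) (hk.intervalIntegrable x 1)
      rw [h1, hmean, add_zero] at h2
      exact h2
  have hts : tsupport z ⊆ Icc a b := by
    refine closure_minimal (fun x hx => ?_) isClosed_Icc
    by_contra h
    exact hx (hz0 x h)
  have := hT z ⟨?_, HasCompactSupport.intro isCompact_Icc (fun x hx => hz0 x hx), ?_, hbd⟩
  · rwa [hderiv] at this
  · rw [contDiff_one_iff_deriv, hderiv]
    exact ⟨fun x => (hd x).differentiableAt, hk⟩
  · exact hts.trans (Icc_subset_Ioo ha hb)

lemma integral_mul_abs_le_of_forall_continuous {D ψ : ℝ → ℝ} {C : ℝ} (hD : Integrable D)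
    (hψ : Continuous ψ) (hψ0 : ∀ x, 0 ≤ ψ x) (hψ1 : ∀ x, ψ x ≤ 1) (hψc : HasCompactSupport ψ)
    (H : ∀ g : ℝ → ℝ, Continuous g → (∀ x, |g x| ≤ ψ x) → ∫ x, g x * D x ≤ C) :
    ∫ x, ψ x * |D x| ≤ C := by
  have hψi : Integrable ψ := hψ.integrable_of_hasCompactSupport hψc
  set I := ∫ x, ψ x
  have hI : 0 ≤ I := integral_nonneg hψ0
  have hbdd : ∀ {g F : ℝ → ℝ}, Continuous g → (∀ x, |g x| ≤ 1) → Integrable F →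
      Integrable fun x => g x * F x := fun {g F} hg hg1 hF =>
    hF.bdd_mul (c := 1) hg.aestronglyMeasurable (ae_of_all _ hg1)
  have hψa : ∀ x, |ψ x| ≤ 1 := fun x => by rw [abs_of_nonneg (hψ0 x)]; exact hψ1 x
  refine le_of_forall_pos_le_add fun ε hε => ?_
  set e := ε / (2 + I)
  have he : 0 < e := by positivity
  obtain ⟨G, -, hGD, hGc, hGi⟩ := hD.exists_hasCompactSupport_integral_sub_le he
  set g : ℝ → ℝ := fun x => ψ x * (G x / (|G x| + e)) with hg
  have hpos : ∀ x, 0 < |G x| + e := fun x => by positivity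
  have hgc : Continuous g :=
    hψ.mul (hGc.div (hGc.abs.add continuous_const) fun x => (hpos x).ne')
  have hgψ : ∀ x, |g x| ≤ ψ x := by
    intro x
    rw [hg, abs_mul, abs_of_nonneg (hψ0 x), abs_div, abs_of_pos (hpos x)]
    refine mul_le_of_le_one_right (hψ0 x) ?_
    rw [div_le_one (hpos x)]
    linarith
  have hpt : ∀ x, ψ x * |D x| ≤ g x * D x + 2 * ‖D x - G x‖ + e * ψ x := by
    intro x
    have h1 : g x * G x ≥ ψ x * |G x| - e * ψ x := by
      have h2 : |G x| - e ≤ G x / (|G x| + e) * G x := by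
        rw [div_mul_eq_mul_div, le_div_iff₀ (hpos x)]
        nlinarith [sq_abs (G x)]
      have := mul_le_mul_of_nonneg_left h2 (hψ0 x)
      rw [hg]
      linarith
    have h2 : |g x * (D x - G x)| ≤ |D x - G x| := by
      rw [abs_mul]
      exact mul_le_of_le_one_left (abs_nonneg _) ((hgψ x).trans (hψ1 x))
    have h3 : ψ x * |D x| ≤ ψ x * |G x| + |D x - G x| := by
      have h4 : |D x| ≤ |G x| + |D x - G x| := by
        have := abs_add_le (G x) (D x - G x)
        simpa using this
      nlinarith [hψ0 x, hψ1 x, abs_nonneg (D x - G x)]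
    have h5 := neg_abs_le (g x * (D x - G x))
    rw [Real.norm_eq_abs]
    linarith
  have hgD := hbdd hgc (fun x => (hgψ x).trans (hψ1 x)) hD
  have hDG : Integrable fun x => 2 * ‖D x - G x‖ := (hD.sub hGi).norm.const_mul 2
  calc ∫ x, ψ x * |D x| ≤ ∫ x, (g x * D x + 2 * ‖D x - G x‖ + e * ψ x) :=
        integral_mono (hbdd hψ hψa hD.abs) ((hgD.add hDG).add (hψi.const_mul e)) hpt
    _ = (∫ x, g x * D x) + 2 * (∫ x, ‖D x - G x‖) + e * I := by
        have h1 := integral_add (hgD.add hDG) (hψi.const_mul e)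
        have h2 := integral_add hgD hDG
        rw [integral_const_mul] at h1 h2
        rw [← h2]
        exact h1
    _ ≤ C + 2 * e + e * I := by
        have := H g hgc hgψ
        gcongr
    _ = C + ε := by
        have : e * (2 + I) = ε := div_mul_cancel₀ _ (by positivity)
        linarith

lemma integrable_indicator_Ioo_of_memL2w {n : ℕ} {u : ℝ → ℝ}
    (hu : MemL2w (fun r => r ^ n) u) {c : ℝ} (hc : 0 < c) :
    Integrable ((Ioo c 1).indicator u) :=
  (integrable_indicator_iff measurableSet_Ioo).2 (hu.integrableOn_Ioo hc)

lemma setIntegral_Ioo_eq_integral_indicator {u k : ℝ → ℝ} {a b c : ℝ} (hc : 0 < c)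
    (hca : c < a) (hb : b < 1) (hk : ∀ x ∉ Icc a b, k x = 0) :
    ∫ x in Ioo (0 : ℝ) 1, u x * k x = ∫ x, (Ioo c 1).indicator u x * k x := by
  rw [← integral_indicator measurableSet_Ioo]
  congr 1
  ext x
  by_cases hx : x ∈ Icc a b
  · have h1 : x ∈ Ioo c 1 := ⟨hca.trans_le hx.1, hx.2.trans_lt hb⟩
    have h0 : x ∈ Ioo (0 : ℝ) 1 := ⟨hc.trans h1.1, h1.2⟩
    simp [indicator, h1.1, h1.2, h0.1]
  · simp [indicator, hk x hx]

/-- A function of bounded weighted variation is essentially bounded away from the origin. -/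
lemma TVBound.exists_ae_abs_le {n : ℕ} {u : ℝ → ℝ} {T δ : ℝ} (hT : TVBound n u T)
    (hu : MemL2w (fun r => r ^ n) u) (hδ : δ ∈ Ioo (0 : ℝ) 1) :
    ∃ M, ∀ᵐ x ∂volume.restrict (Ioo δ 1), |u x| ≤ M := by
  obtain ⟨hδ0, hδ1⟩ := hδ
  have hδn : 0 < δ ^ n := pow_pos hδ0 n
  set w := (Ioo δ 1).indicator u with hw
  have hwi : Integrable w := integrable_indicator_Ioo_of_memL2w hu hδ0
  have hbump : ∀ (x : ℝ) (η : ContDiffBump x), Metric.closedBall x η.rOut ⊆ Ioo δ 1 →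
      ∀ y ∉ Icc (x - η.rOut) (x + η.rOut), η.normed volume y = 0 := by
    intro x η _ y hy
    rw [← Real.closedBall_eq_Icc, ← η.tsupport_normed_eq (μ := volume)] at hy
    exact image_eq_zero_of_notMem_tsupport hy
  set x₀ := (δ + 1) / 2 with hx₀
  let η : ContDiffBump x₀ := ⟨(1 - δ) / 8, (1 - δ) / 4, by linarith, by linarith⟩
  set N := ∫ y, w y * η.normed volume y
  have key : ∀ (x : ℝ) (g : ContDiffBump x), Metric.closedBall x g.rOut ⊆ Ioo δ 1 →
      |∫ y, w y * g.normed volume y| ≤ T / δ ^ n + |N| := by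
    intro x g hg
    have hηo : η.rOut = (1 - δ) / 4 := rfl
    have hη : Metric.closedBall x₀ η.rOut ⊆ Ioo δ 1 := by
      rw [Real.closedBall_eq_Icc, hηo]
      exact Icc_subset_Ioo (by linarith) (by linarith)
    have hg0 := hbump x g hg
    have hη0 := hbump x₀ η hη
    rw [Real.closedBall_eq_Icc] at hg hη
    have hgo := g.rOut_pos
    have hηp := η.rOut_pos
    have hga := hg (left_mem_Icc.2 (by linarith))
    have hgb := hg (right_mem_Icc.2 (by linarith))
    have hηa := hη (left_mem_Icc.2 (by linarith))
    have hηb := hη (right_mem_Icc.2 (by linarith))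
    set a := min (x - g.rOut) (x₀ - η.rOut)
    set b := max (x + g.rOut) (x₀ + η.rOut)
    have ha : δ < a := lt_min hga.1 hηa.1
    have hb : b < 1 := max_lt hgb.2 hηb.2
    have hgs : ∀ y ∉ Icc a b, g.normed volume y = 0 := fun y hy => hg0 y fun h =>
      hy ⟨(min_le_left _ _).trans h.1, h.2.trans (le_max_left _ _)⟩
    have hηs : ∀ y ∉ Icc a b, η.normed volume y = 0 := fun y hy => hη0 y fun h =>
      hy ⟨(min_le_right _ _).trans h.1, h.2.trans (le_max_right _ _)⟩
    have hprim : ∀ {x : ℝ} (g : ContDiffBump x), (∀ y ∉ Icc a b, g.normed volume y = 0) →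
        (∀ y, (∫ t in (0 : ℝ)..y, g.normed volume t) ≤ 1) ∧
        (∀ y, 0 ≤ y → 0 ≤ ∫ t in (0 : ℝ)..y, g.normed volume t) ∧
        (∀ y ≤ δ, ∫ t in (0 : ℝ)..y, g.normed volume t = 0) ∧
        ∫ t in (0 : ℝ)..1, g.normed volume t = 1 := by
      intro x g hgs
      have hgi : Integrable (g.normed volume) := g.integrable_normed
      have hz : ∀ y ≤ δ, ∫ t in (0 : ℝ)..y, g.normed volume t = 0 := by
        intro y hy
        refine (intervalIntegral.integral_congr (g := fun _ => 0) fun t ht => ?_).trans (by simp)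
        refine hgs t fun h => ?_
        have h1 := ht.2
        have h2 := h.1
        have : max 0 y ≤ δ := max_le hδ0.le hy
        linarith
      refine ⟨fun y => ?_, fun y hy => ?_, hz, ?_⟩
      · rcases le_or_gt y 0 with hy | hy
        · rw [hz y (hy.trans hδ0.le)]
          exact zero_le_one
        · rw [intervalIntegral.integral_of_le hy.le, ← g.integral_normed (μ := volume)]
          exact setIntegral_le_integral hgi (ae_of_all _ g.nonneg_normed)
      · exact intervalIntegral.integral_nonneg hy fun t _ => g.nonneg_normed t
      · rw [intervalIntegral.integral_of_le zero_le_one]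
        refine (setIntegral_eq_integral_of_forall_compl_eq_zero fun t ht => hgs t fun h =>
          ht ?_).trans (g.integral_normed (μ := volume))
        exact ⟨hδ0.trans (ha.trans_le h.1), h.2.trans hb.le⟩
    obtain ⟨g1, g2, g3, g4⟩ := hprim g hgs
    obtain ⟨e1, e2, e3, e4⟩ := hprim η hηs
    have hgc : Continuous (g.normed volume) := g.continuous_normed
    have hηc : Continuous (η.normed volume) := η.continuous_normed
    have hprimk : ∀ s y : ℝ, ∫ t in (0 : ℝ)..y, s * (g.normed volume t - η.normed volume t) =
        s * ((∫ t in (0 : ℝ)..y, g.normed volume t) - ∫ t in (0 : ℝ)..y, η.normed volume t) := by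
      intro s y
      rw [intervalIntegral.integral_const_mul, intervalIntegral.integral_sub
        (hgc.intervalIntegrable _ _) (hηc.intervalIntegrable _ _)]
    have hs : ∀ s : ℝ, |s| = δ ^ n →
        s * ((∫ y, w y * g.normed volume y) - N) ≤ T := by
      intro s hs
      have hks : ∀ y ∉ Icc a b, s * (g.normed volume y - η.normed volume y) = 0 := fun y hy => by
        rw [hgs y hy, hηs y hy]; ring
      have := hT.integral_mul_le (k := fun y => s * (g.normed volume y - η.normed volume y))
        (continuous_const.mul (hgc.sub hηc)) (hδ0.trans ha) hb hks
        (by rw [hprimk, g4, e4]; ring) ?_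
      · rw [setIntegral_Ioo_eq_integral_indicator hδ0 ha hb hks] at this
        have hwb : ∀ {x : ℝ} (g : ContDiffBump x),
            Integrable fun y => w y * g.normed volume y := fun {x} g => by
          refine hwi.mul_bdd (c := 1 / volume.real (Metric.closedBall x g.rIn))
            g.continuous_normed.aestronglyMeasurable (ae_of_all _ fun y => ?_)
          rw [Real.norm_eq_abs, abs_of_nonneg (g.nonneg_normed y)]
          exact g.normed_le_div_measure_closedBall_rIn volume y
        rw [← integral_sub (hwb g) (hwb η), ← integral_const_mul]
        refine le_of_eq_of_le (integral_congr_ae (ae_of_all _ fun y => ?_)) this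
        simp only [← hw]
        ring
      · intro y hy
        rw [hprimk, abs_mul, hs]
        rcases le_or_gt y δ with h | h
        · rw [g3 y h, e3 y h]
          simpa using pow_nonneg hy.1.le n
        · have h1 := g1 y
          have h2 := g2 y hy.1.le
          have h3 := e1 y
          have h4 := e2 y hy.1.le
          refine le_trans (mul_le_of_le_one_right hδn.le (abs_le.2 ⟨?_, ?_⟩))
            (pow_le_pow_left₀ hδ0.le h.le n) <;> linarith
    have hp := hs (δ ^ n) (abs_of_pos hδn)
    have hm := hs (-δ ^ n) (by rw [abs_neg, abs_of_pos hδn])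
    have hd : |(∫ y, w y * g.normed volume y) - N| ≤ T / δ ^ n := by
      rw [abs_le, neg_le, le_div_iff₀ hδn, le_div_iff₀ hδn]
      constructor <;> linarith
    have := abs_add_le ((∫ y, w y * g.normed volume y) - N) N
    rw [sub_add_cancel] at this
    linarith
  refine ⟨T / δ ^ n + |N|, ?_⟩
  let φ : ℕ → ContDiffBump (0 : ℝ) := fun i =>
    ⟨1 / ((i : ℝ) + 1) / 2, 1 / ((i : ℝ) + 1), by positivity, half_lt_self (by positivity)⟩
  have hφ : Tendsto (fun i => (φ i).rOut) atTop (𝓝 0) := tendsto_one_div_add_atTop_nhds_zero_nat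
  have hconv := ContDiffBump.ae_convolution_tendsto_right_of_locallyIntegrable (μ := volume)
    (K := 2) hφ (Eventually.of_forall fun i => by
      change 1 / ((i : ℝ) + 1) ≤ 2 * (1 / ((i : ℝ) + 1) / 2)
      linarith) hwi.locallyIntegrable
  rw [ae_restrict_iff' measurableSet_Ioo]
  filter_upwards [hconv] with x hx hxδ
  have hwx : w x = u x := indicator_of_mem hxδ u
  rw [← hwx]
  refine le_of_tendsto hx.abs ?_
  obtain ⟨r, hr, hball⟩ := Metric.isOpen_iff.1 isOpen_Ioo x hxδ
  filter_upwards [hφ.eventually_lt_const hr] with i hi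
  let g : ContDiffBump x := ⟨(φ i).rIn, (φ i).rOut, (φ i).rIn_pos, (φ i).rIn_lt_rOut⟩
  have hgx : ∀ y, (φ i).normed volume (x - y) = g.normed volume y := by
    have h1 : ∀ y, (φ i) (y - x) = g y := fun y => by
      rw [ContDiffBump.apply, ContDiffBump.apply, sub_zero]
    intro y
    rw [← neg_sub, ContDiffBump.normed_neg, ContDiffBump.normed_def, ContDiffBump.normed_def,
      ← integral_sub_right_eq_self (φ i) x, h1]
    simp only [h1]
  have := key x g ((Metric.closedBall_subset_ball hi).trans hball)
  rw [convolution_eq_swap]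
  simp only [ContinuousLinearMap.lsmul_apply, smul_eq_mul, hgx, mul_comm _ (w _)]
  exact this

/-- The weighted `L¹` norm of difference quotients is bounded by the weighted total variation. -/
lemma TVBound.integral_mul_abs_sub_le {n : ℕ} {u ψ : ℝ → ℝ} {T a b c h : ℝ}
    (hT : TVBound n u T) (hu : MemL2w (fun r => r ^ n) u) (hc : 0 < c) (hca : c < a)
    (hψ : Continuous ψ) (hψ0 : ∀ x, 0 ≤ ψ x) (hψs : ∀ x ∉ Icc a b, ψ x = 0)
    (hψn : ∀ x ∈ Ioo (0 : ℝ) 1, ψ x ≤ x ^ n) (hh : 0 < h) (hbh : b + h < 1) :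
    ∫ x, ψ x * |(Ioo c 1).indicator u (x + h) - (Ioo c 1).indicator u x| ≤ h * T := by
  set w := (Ioo c 1).indicator u with hw
  have hwi : Integrable w := integrable_indicator_Ioo_of_memL2w hu hc
  have hwh : Integrable fun x => w (x + h) := hwi.comp_add_right h
  have hle : ∀ t y, t ≤ y → y ∈ Ioo (0 : ℝ) 1 → ψ t ≤ y ^ n := by
    intro t y hty hy
    by_cases ht : t ∈ Icc a b
    · have ht0 : 0 < t := hc.trans (hca.trans_le ht.1)
      exact (hψn t ⟨ht0, hty.trans_lt hy.2⟩).trans (pow_le_pow_left₀ ht0.le hty n)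
    · rw [hψs t ht]
      exact pow_nonneg hy.1.le n
  have hψ1 : ∀ x, ψ x ≤ 1 := by
    intro x
    by_cases hx : x ∈ Icc a b
    · have hx0 : 0 < x := hc.trans (hca.trans_le hx.1)
      have hx1 : x < 1 := by linarith [hx.2]
      exact (hψn x ⟨hx0, hx1⟩).trans (pow_le_one₀ hx0.le hx1.le)
    · rw [hψs x hx]
      exact zero_le_one
  refine integral_mul_abs_le_of_forall_continuous (hwh.sub hwi) hψ hψ0 hψ1
    (HasCompactSupport.intro isCompact_Icc hψs) fun g hg hgψ => ?_
  have hgs : ∀ x ∉ Icc a b, g x = 0 := fun x hx => by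
    have := hgψ x
    rw [hψs x hx] at this
    exact abs_nonpos_iff.1 this
  set k : ℝ → ℝ := fun x => (g (x - h) - g x) / h with hk
  have hgh : Continuous fun x => g (x - h) := hg.comp (continuous_id.sub continuous_const)
  have hkc : Continuous k := (hgh.sub hg).div_const h
  have hks : ∀ x ∉ Icc a (b + h), k x = 0 := by
    intro x hx
    have h1 : g x = 0 := hgs x fun h' => hx ⟨h'.1, by linarith [h'.2]⟩
    have h2 : g (x - h) = 0 := hgs _ fun h' => hx ⟨by linarith [h'.1], by linarith [h'.2]⟩
    rw [hk]
    simp [h1, h2]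
  have hg0 : ∫ t in (-h)..0, g t = 0 := by
    refine (intervalIntegral.integral_congr (g := fun _ => 0) fun t ht => ?_).trans (by simp)
    rw [uIcc_of_le (by linarith)] at ht
    exact hgs t fun h' => by linarith [h'.1, ht.2]
  have hprim : ∀ x, ∫ t in (0 : ℝ)..x, k t = -(∫ t in (x - h)..x, g t) / h := by
    intro x
    rw [intervalIntegral.integral_div, intervalIntegral.integral_sub
      (hgh.intervalIntegrable _ _) (hg.intervalIntegrable _ _),
      intervalIntegral.integral_comp_sub_right (fun t => g t), zero_sub]
    have h1 := intervalIntegral.integral_add_adjacent_intervals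
        (hg.intervalIntegrable (μ := volume) (-h) 0) (hg.intervalIntegrable 0 x)
    have h2 := intervalIntegral.integral_add_adjacent_intervals
        (hg.intervalIntegrable (μ := volume) (-h) (x - h)) (hg.intervalIntegrable (x - h) x)
    congr 1
    linarith
  have hmain := hT.integral_mul_le hkc (hc.trans hca) hbh hks ?_ ?_
  · rw [setIntegral_Ioo_eq_integral_indicator hc hca hbh hks, ← hw] at hmain
    have hgb : ∀ {F : ℝ → ℝ}, Integrable F → Integrable fun x => g x * F x := fun {F} hF =>
      hF.bdd_mul (c := 1) hg.aestronglyMeasurable (ae_of_all _ fun x => (hgψ x).trans (hψ1 x))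
    have hgb' : Integrable fun x => g (x - h) * w x := by
      have := (hgb hwh).comp_sub_right h
      simpa using this
    have e1 : ∫ x, g x * w (x + h) = ∫ x, g (x - h) * w x := by
      rw [← integral_sub_right_eq_self (fun x => g x * w (x + h)) h]
      simp
    have e2 : ∫ x, g x * (w (x + h) - w x) = h * ∫ x, w x * k x := by
      simp only [mul_sub]
      rw [integral_sub (hgb hwh) (hgb hwi), e1, ← integral_sub hgb' (hgb hwi),
        ← integral_const_mul]
      congr 1
      ext x
      rw [hk]
      field_simp
    rw [e2]
    gcongr
  · rw [hprim]
    have : ∫ t in (1 - h)..1, g t = 0 := by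
      refine (intervalIntegral.integral_congr (g := fun _ => 0) fun t ht => ?_).trans (by simp)
      rw [uIcc_of_le (by linarith)] at ht
      exact hgs t fun h' => by linarith [h'.2, ht.1]
    rw [this]
    simp
  · intro x hx
    rw [hprim, abs_div, abs_neg, abs_of_pos hh, div_le_iff₀ hh]
    have := intervalIntegral.norm_integral_le_of_norm_le_const (a := x - h) (b := x) (f := g)
      (C := x ^ n) fun t ht => by
        rw [uIoc_of_le (by linarith)] at ht
        exact (hgψ t).trans (hle t x ht.2 hx)
    simpa [abs_of_pos hh] using this

lemma tendsto_integral_mul_slope {w z : ℝ → ℝ} (hw : Integrable w) (hz : ContDiff ℝ 1 z)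
    (hzc : HasCompactSupport z) :
    Tendsto (fun h : ℝ => ∫ x, w x * ((z x - z (x - h)) / h)) (𝓝[>] 0)
      (𝓝 (∫ x, w x * deriv z x)) := by
  obtain ⟨K, hK⟩ := hz.lipschitzWith_of_hasCompactSupport hzc one_ne_zero
  refine tendsto_integral_filter_of_dominated_convergence (fun x => K * ‖w x‖) ?_ ?_
    (hw.norm.const_mul _) ?_
  · refine Eventually.of_forall fun h => hw.aestronglyMeasurable.mul ?_
    have := hz.continuous
    exact (by fun_prop : Continuous fun x => (z x - z (x - h)) / h).aestronglyMeasurable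
  · filter_upwards [self_mem_nhdsWithin] with h hh
    refine ae_of_all _ fun x => ?_
    have := hK.norm_sub_le x (x - h)
    rw [sub_sub_cancel] at this
    rw [norm_mul, mul_comm, norm_div]
    gcongr
    rw [div_le_iff₀ (norm_pos_iff.2 (ne_of_gt hh))]
    exact this
  · refine ae_of_all _ fun x => Tendsto.const_mul _ ?_
    have hd := (hz.differentiable one_ne_zero x).hasDerivAt.tendsto_slope
    have hlim : Tendsto (fun h : ℝ => x - h) (𝓝[>] 0) (𝓝[≠] x) := by
      refine tendsto_nhdsWithin_iff.2 ⟨?_, ?_⟩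
      · have : Tendsto (fun h : ℝ => x - h) (𝓝 0) (𝓝 (x - 0)) :=
          tendsto_const_nhds.sub tendsto_id
        rw [sub_zero] at this
        exact this.mono_left nhdsWithin_le_nhds
      · filter_upwards [self_mem_nhdsWithin] with h hh
        have : (0 : ℝ) < h := hh
        simp [this.ne']
    refine (hd.comp hlim).congr fun h => ?_
    simp only [Function.comp, slope_def_field]
    rw [← neg_div_neg_eq]
    congr 1 <;> ring

/-- Splitting `u = F u + G u` without cancellation splits the weighted total variation. -/
lemma TVBound.integral_comp_add_integral_comp_le {n : ℕ} {u : ℝ → ℝ} {T : ℝ}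
    (hT : TVBound n u T) (hu : MemL2w (fun r => r ^ n) u) {F G : ℝ → ℝ}
    (hFu : MemL2w (fun r => r ^ n) (fun x => F (u x)))
    (hGu : MemL2w (fun r => r ^ n) (fun x => G (u x)))
    (hFG : ∀ s t, |F s - F t| + |G s - G t| ≤ |s - t|) {z₁ z₂ : ℝ → ℝ}
    (h₁ : IsTest n z₁) (h₂ : IsTest n z₂) :
    (∫ x in Ioo (0 : ℝ) 1, F (u x) * deriv z₁ x) +
      ∫ x in Ioo (0 : ℝ) 1, G (u x) * deriv z₂ x ≤ T := by
  obtain ⟨a, b, ha, hab, hb, hsub⟩ := IsCompact.exists_Icc_of_subset_Ioo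
    (h₁.2.1.isCompact.union h₂.2.1.isCompact) (union_subset h₁.2.2.1 h₂.2.2.1)
  have hz₁ : ∀ x ∉ Icc a b, x ∉ tsupport z₁ := fun x hx h => hx (hsub (Or.inl h))
  have hz₂ : ∀ x ∉ Icc a b, x ∉ tsupport z₂ := fun x hx h => hx (hsub (Or.inr h))
  have e₁ : ∀ x ∉ Icc a b, z₁ x = 0 := fun x hx => image_eq_zero_of_notMem_tsupport (hz₁ x hx)
  have e₂ : ∀ x ∉ Icc a b, z₂ x = 0 := fun x hx => image_eq_zero_of_notMem_tsupport (hz₂ x hx)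
  have d₁ : ∀ x ∉ Icc a b, deriv z₁ x = 0 := fun x hx => by
    by_contra h
    exact hz₁ x hx (support_deriv_subset h)
  have d₂ : ∀ x ∉ Icc a b, deriv z₂ x = 0 := fun x hx => by
    by_contra h
    exact hz₂ x hx (support_deriv_subset h)
  set c := a / 2 with hc
  have hc0 : 0 < c := by positivity
  have hca : c < a := half_lt_self ha
  rw [setIntegral_Ioo_eq_integral_indicator hc0 hca hb d₁,
    setIntegral_Ioo_eq_integral_indicator hc0 hca hb d₂]
  set v := (Ioo c 1).indicator fun x => F (u x) with hv
  set p := (Ioo c 1).indicator fun x => G (u x) with hp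
  set w := (Ioo c 1).indicator u with hw
  have hvi : Integrable v := integrable_indicator_Ioo_of_memL2w hFu hc0
  have hpi : Integrable p := integrable_indicator_Ioo_of_memL2w hGu hc0
  have hwi : Integrable w := integrable_indicator_Ioo_of_memL2w hu hc0
  refine le_of_tendsto ((tendsto_integral_mul_slope hvi h₁.1 h₁.2.1).add
    (tendsto_integral_mul_slope hpi h₂.1 h₂.2.1)) ?_
  filter_upwards [Ioo_mem_nhdsGT (sub_pos.2 hb)] with h hh
  obtain ⟨hh0, hhb⟩ := hh
  have hbh : b + h < 1 := by linarith
  set ψ : ℝ → ℝ := fun x => max |z₁ x| |z₂ x| with hψ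
  have hψc : Continuous ψ := h₁.1.continuous.abs.max h₂.1.continuous.abs
  have hψs : ∀ x ∉ Icc a b, ψ x = 0 := fun x hx => by simp [hψ, e₁ x hx, e₂ x hx]
  have hψ0 : ∀ x, 0 ≤ ψ x := fun x => (abs_nonneg _).trans (le_max_left _ _)
  have hL := hT.integral_mul_abs_sub_le hu hc0 hca hψc hψ0 hψs
    (fun x hx => max_le (h₁.2.2.2 x hx) (h₂.2.2.2 x hx)) hh0 hbh
  rw [← hw] at hL
  have hbd : ∀ {z q : ℝ → ℝ}, Continuous z → HasCompactSupport z → Integrable q →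
      Integrable fun x => q x * z x := by
    intro z q hz hzc hq
    obtain ⟨C, hC⟩ := hzc.exists_bound_of_continuous hz
    exact hq.mul_bdd hz.aestronglyMeasurable (ae_of_all _ hC)
  have hparts : ∀ {z q : ℝ → ℝ}, Continuous z → HasCompactSupport z → Integrable q →
      ∫ x, q x * ((z x - z (x - h)) / h) = -(∫ x, (q (x + h) - q x) * z x) / h := by
    intro z q hz hzc hq
    have i1 : Integrable fun x => q (x + h) * z x := hbd hz hzc (hq.comp_add_right h)
    have i2 : Integrable fun x => q x * z (x - h) := by
      have := i1.comp_sub_right h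
      simpa using this
    have e1 : ∫ x, q (x + h) * z x = ∫ x, q x * z (x - h) := by
      rw [← integral_sub_right_eq_self (fun x => q (x + h) * z x) h]
      simp
    simp only [sub_mul]
    rw [integral_sub i1 (hbd hz hzc hq), e1, ← integral_sub i2 (hbd hz hzc hq), ← integral_neg,
      ← integral_div]
    congr 1
    ext x
    ring
  have j1 : Integrable fun x => (v (x + h) - v x) * z₁ x :=
    hbd h₁.1.continuous h₁.2.1 ((hvi.comp_add_right h).sub hvi)
  have j2 : Integrable fun x => (p (x + h) - p x) * z₂ x :=
    hbd h₂.1.continuous h₂.2.1 ((hpi.comp_add_right h).sub hpi)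
  have j3 : Integrable fun x => |w (x + h) - w x| * ψ x :=
    hbd hψc (HasCompactSupport.intro isCompact_Icc hψs)
    ((hwi.comp_add_right h).sub hwi).abs
  rw [hparts h₁.1.continuous h₁.2.1 hvi, hparts h₂.1.continuous h₂.2.1 hpi, ← add_div,
    div_le_iff₀ hh0, mul_comm T]
  refine le_trans ?_ hL
  rw [← neg_add, ← integral_add j1 j2, ← integral_neg]
  refine integral_mono (j1.add j2).neg (by simpa only [mul_comm] using j3) fun x => ?_
  by_cases hx : x ∈ Icc a b
  · have m1 : x ∈ Ioo c 1 := ⟨hca.trans_le hx.1, hx.2.trans_lt hb⟩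
    have m2 : x + h ∈ Ioo c 1 := ⟨by linarith [m1.1], by linarith [hx.2]⟩
    simp only [hv, hp, hw, indicator_of_mem m1, indicator_of_mem m2]
    have t1 := neg_abs_le ((F (u (x + h)) - F (u x)) * z₁ x)
    have t2 := neg_abs_le ((G (u (x + h)) - G (u x)) * z₂ x)
    rw [abs_mul] at t1 t2
    have s1 := mul_le_mul_of_nonneg_left (le_max_left |z₁ x| |z₂ x|)
      (abs_nonneg (F (u (x + h)) - F (u x)))
    have s2 := mul_le_mul_of_nonneg_left (le_max_right |z₁ x| |z₂ x|)
      (abs_nonneg (G (u (x + h)) - G (u x)))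
    have s3 := mul_le_mul_of_nonneg_left (hFG (u (x + h)) (u x)) (hψ0 x)
    simp only [hψ] at s3 ⊢
    linarith
  · simp [e₁ x hx, e₂ x hx, hψs x hx]

lemma integrableOn_pow_Ioo (n : ℕ) : IntegrableOn (fun x : ℝ => x ^ n) (Ioo 0 1) :=
  (continuous_pow n).integrableOn_Icc.mono_set Ioo_subset_Icc_self

lemma MemL2w.of_sq_le {n : ℕ} {u v : ℝ → ℝ} {C : ℝ} (hu : MemL2w (fun r => r ^ n) u)
    (hv : AEMeasurable v (volume.restrict (Ioo 0 1))) (h : ∀ x, v x ^ 2 ≤ 2 * u x ^ 2 + C) :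
    MemL2w (fun r => r ^ n) v := by
  refine ⟨hv, ((hu.2.const_mul 2).add ((integrableOn_pow_Ioo n).const_mul C)).mono'
    ((hv.pow_const 2).mul (by fun_prop)).aestronglyMeasurable ?_⟩
  filter_upwards [ae_restrict_mem measurableSet_Ioo] with x hx
  have hp := pow_nonneg hx.1.le n
  rw [Real.norm_eq_abs, abs_of_nonneg (mul_nonneg (sq_nonneg _) hp)]
  simp only [Pi.add_apply]
  nlinarith [h x]

lemma MemL2w.integrableOn_mul {n : ℕ} {u v : ℝ → ℝ} (hu : MemL2w (fun r => r ^ n) u)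
    (hv : MemL2w (fun r => r ^ n) v) : IntegrableOn (fun x => u x * v x * x ^ n) (Ioo 0 1) := by
  refine (hu.2.add hv.2).mono' ((hu.1.mul hv.1).mul (by fun_prop)).aestronglyMeasurable ?_
  filter_upwards [ae_restrict_mem measurableSet_Ioo] with x hx
  have hp := pow_nonneg hx.1.le n
  rw [norm_mul, Real.norm_eq_abs, Real.norm_eq_abs, abs_of_nonneg hp]
  simp only [Pi.add_apply]
  rw [← add_mul]
  refine mul_le_mul_of_nonneg_right (abs_le.2 ⟨?_, ?_⟩) hp <;>
    nlinarith [sq_nonneg (u x - v x), sq_nonneg (u x + v x)]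

lemma MemL2w.sub {n : ℕ} {u v : ℝ → ℝ} (hu : MemL2w (fun r => r ^ n) u)
    (hv : MemL2w (fun r => r ^ n) v) : MemL2w (fun r => r ^ n) fun x => u x - v x := by
  refine ⟨hu.1.sub hv.1, ?_⟩
  refine ((hu.2.sub ((hu.integrableOn_mul hv).const_mul 2)).add hv.2).congr
    (ae_of_all _ fun x => ?_)
  simp only [Pi.add_apply, Pi.sub_apply]
  ring

lemma MemL2w.integrableOn_mul_deriv {n : ℕ} {u z : ℝ → ℝ} (hu : MemL2w (fun r => r ^ n) u)
    (hz : IsTest n z) : IntegrableOn (fun x => u x * deriv z x) (Ioo 0 1) := by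
  obtain ⟨a, b, ha, -, hb, hsub⟩ :=
    IsCompact.exists_Icc_of_subset_Ioo hz.2.1.isCompact hz.2.2.1
  have hd : Continuous (deriv z) := hz.1.continuous_deriv_one
  obtain ⟨C, hC⟩ := hz.2.1.deriv.exists_bound_of_continuous hd
  have hi : Integrable fun x => (Ioo (a / 2) 1).indicator u x * deriv z x :=
    (integrable_indicator_Ioo_of_memL2w hu (half_pos ha)).mul_bdd hd.aestronglyMeasurable
      (ae_of_all _ hC)
  refine hi.integrableOn.congr (ae_of_all _ fun x => ?_)
  by_cases hx : x ∈ Icc a b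
  · have : x ∈ Ioo (a / 2) 1 := ⟨(half_lt_self ha).trans_le hx.1, hx.2.trans_lt hb⟩
    simp only [indicator_of_mem this]
  · have : deriv z x = 0 := by
      by_contra h
      exact hx (hsub (support_deriv_subset h))
    simp only [this, mul_zero]

/-- First-order optimality of a minimizer tested with the indicator of a ball. -/
lemma setIntegral_sub_mul_pow_le {n : ℕ} {f u : ℝ → ℝ} {α T s : ℝ}
    (hf : MemL2w (fun r => r ^ n) f) (hu : MemL2w (fun r => r ^ n) u) (hT : TVBound n u T)
    (hmin : ∀ v S, MemL2w (fun r => r ^ n) v → TVBound n v S →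
      (∫ x in Ioo (0 : ℝ) 1, (u x - f x) ^ 2 * x ^ n) + α * T ≤
        (∫ x in Ioo (0 : ℝ) 1, (v x - f x) ^ 2 * x ^ n) + α * S)
    (hs : s ∈ Ioo (0 : ℝ) 1) :
    ∫ x in Ioo 0 s, (f x - u x) * x ^ n ≤ α / 2 * s ^ n := by
  have hsub : Ioo 0 s ⊆ Ioo (0 : ℝ) 1 := Ioo_subset_Ioo_right hs.2.le
  have hinter : Ioo (0 : ℝ) 1 ∩ Ioo 0 s = Ioo 0 s := inter_eq_right.2 hsub
  set χ : ℝ → ℝ := (Ioo 0 s).indicator fun _ => 1 with hχ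
  have hχm : Measurable χ := measurable_const.indicator measurableSet_Ioo
  have hχ01 : ∀ x, χ x = 0 ∨ χ x = 1 := fun x => by
    by_cases h : x ∈ Ioo 0 s <;> simp [hχ, h]
  have hχL : MemL2w (fun r => r ^ n) χ := by
    refine (memL2w_zero _).of_sq_le (C := 1) hχm.aemeasurable fun x => ?_
    rcases hχ01 x with h | h <;> simp [h]
  have hχint : ∀ F : ℝ → ℝ, ∫ x in Ioo (0 : ℝ) 1, χ x * F x = ∫ x in Ioo 0 s, F x := by
    intro F
    have : ∀ x, χ x * F x = (Ioo 0 s).indicator F x := fun x => by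
      by_cases h : x ∈ Ioo 0 s <;> simp [hχ, h]
    simp only [this]
    rw [setIntegral_indicator measurableSet_Ioo, hinter]
  have hv : ∀ t, MemL2w (fun r => r ^ n) fun x => u x + t * χ x := by
    intro t
    refine hu.of_sq_le (C := 2 * t ^ 2) (hu.1.add (hχm.const_mul t).aemeasurable) fun x => ?_
    rcases hχ01 x with h | h <;> rw [h] <;> nlinarith [sq_nonneg (u x), sq_nonneg (u x - t)]
  have hvT : ∀ t, 0 < t → TVBound n (fun x => u x + t * χ x) (T + t * s ^ n) := by
    intro t ht z hz
    have h1 := hu.integrableOn_mul_deriv hz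
    have h2 := (hχL.integrableOn_mul_deriv hz).const_mul t
    have h3 : ∫ x in Ioo 0 s, deriv z x = z s := by
      rw [← integral_Ioc_eq_integral_Ioo, ← intervalIntegral.integral_of_le hs.1.le,
        intervalIntegral.integral_deriv_eq_sub
          (fun x _ => hz.1.differentiable one_ne_zero x)
          (hz.1.continuous_deriv_one.intervalIntegrable _ _),
        image_eq_zero_of_notMem_tsupport (fun h => lt_irrefl _ (hz.2.2.1 h).1), sub_zero]
    have h4 := (le_abs_self _).trans (hz.2.2.2 s hs)
    simp only [add_mul, mul_assoc]
    rw [integral_add h1 h2, integral_const_mul, hχint, h3]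
    have := hT z hz
    gcongr
  set B := ∫ x in Ioo 0 s, (f x - u x) * x ^ n with hB
  set C := ∫ x in Ioo 0 s, x ^ n with hC
  have hineq : ∀ t, 0 < t → 2 * B - α * s ^ n ≤ t * C := by
    intro t ht
    have h := hmin _ _ (hv t) (hvT t ht)
    have hd := (hf.sub hu)
    have i1 := (hu.sub hf).2
    have i2 := (hχL.integrableOn_mul hd).const_mul (2 * t)
    have i12 : IntegrableOn
        (fun x => (u x - f x) ^ 2 * x ^ n - 2 * t * (χ x * (f x - u x) * x ^ n)) (Ioo 0 1) :=
      i1.sub i2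
    have i3 : IntegrableOn (fun x => t ^ 2 * (χ x ^ 2 * x ^ n)) (Ioo 0 1) :=
      hχL.2.const_mul (t ^ 2)
    have e : ∫ x in Ioo (0 : ℝ) 1, (u x + t * χ x - f x) ^ 2 * x ^ n =
        (∫ x in Ioo (0 : ℝ) 1, (u x - f x) ^ 2 * x ^ n) - 2 * t * B + t ^ 2 * C := by
      have e1 : ∫ x in Ioo (0 : ℝ) 1, χ x * (f x - u x) * x ^ n = B := by
        simp only [mul_assoc]
        exact hχint _
      have e2 : ∫ x in Ioo (0 : ℝ) 1, χ x ^ 2 * x ^ n = C := by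
        have : ∀ x, χ x ^ 2 * x ^ n = χ x * x ^ n := fun x => by
          rcases hχ01 x with h | h <;> simp [h]
        simp only [this]
        exact hχint _
      rw [← e1, ← e2, ← integral_const_mul, ← integral_const_mul, ← integral_sub i1 i2,
        ← integral_add i12 i3]
      congr 1
      ext x
      ring
    rw [e] at h
    have : t * (2 * B - α * s ^ n) ≤ t * (t * C) := by linarith
    exact le_of_mul_le_mul_left this ht
  have hlim : Tendsto (fun t : ℝ => t * C) (𝓝[>] 0) (𝓝 0) := by
    have : Tendsto (fun t : ℝ => t * C) (𝓝 0) (𝓝 (0 * C)) := tendsto_id.mul_const C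
    rw [zero_mul] at this
    exact this.mono_left nhdsWithin_le_nhds
  have := ge_of_tendsto hlim (eventually_nhdsWithin_of_forall fun t ht => hineq t ht)
  linarith

lemma eLpNorm_top_lt_top_iff_exists_ae_abs_le {u : ℝ → ℝ} {μ : Measure ℝ} :
    eLpNorm u ⊤ μ < ⊤ ↔ ∃ M, ∀ᵐ x ∂μ, |u x| ≤ M := by
  rw [eLpNorm_exponent_top]
  refine ⟨fun h => ⟨(eLpNormEssSup u μ).toReal, ?_⟩, fun ⟨M, hM⟩ =>
    eLpNormEssSup_lt_top_of_ae_bound hM⟩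
  filter_upwards [enorm_ae_le_eLpNormEssSup u μ] with x hx
  have := ENNReal.toReal_mono h.ne hx
  simpa using this

/-- If `r * f r` is large near the origin then the minimizer is unbounded there. -/
lemma eLpNorm_top_eq_top_of_tendsto {n : ℕ} (hn : 1 ≤ n) {f u : ℝ → ℝ} {α T : ℝ}
    (hf : MemL2w (fun r => r ^ n) f) (hu : MemL2w (fun r => r ^ n) u) (hT : TVBound n u T)
    (hmin : ∀ v S, MemL2w (fun r => r ^ n) v → TVBound n v S →
      (∫ x in Ioo (0 : ℝ) 1, (u x - f x) ^ 2 * x ^ n) + α * T ≤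
        (∫ x in Ioo (0 : ℝ) 1, (v x - f x) ^ 2 * x ^ n) + α * S)
    (hlim : Tendsto (fun r => r * f r) (𝓝[>] 0) atTop) {ε : ℝ} (hε : 0 < ε) :
    eLpNorm u ⊤ (volume.restrict (Ioo 0 ε)) = ⊤ := by
  by_contra hne
  obtain ⟨M, hM⟩ := eLpNorm_top_lt_top_iff_exists_ae_abs_le.1 (lt_top_iff_ne_top.2 hne)
  obtain ⟨r, hr, hfr⟩ := mem_nhdsGT_iff_exists_Ioo_subset.1
    (hlim.eventually_ge_atTop ((α / 2 + 1) * n + |M|))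
  have hr : 0 < r := hr
  obtain ⟨s, hs0, hs⟩ := exists_between (show 0 < min (min r ε) 1 by positivity)
  obtain ⟨hs, hs1⟩ := lt_min_iff.1 hs
  obtain ⟨hsr, hsε⟩ := lt_min_iff.1 hs
  have h1 := setIntegral_sub_mul_pow_le hf hu hT hmin ⟨hs0, hs1⟩
  have hint : ∫ x in Ioo 0 s, (α / 2 + 1) * (n * x ^ (n - 1)) = (α / 2 + 1) * s ^ n := by
    rw [integral_const_mul, ← integral_Ioc_eq_integral_Ioo,
      ← intervalIntegral.integral_of_le hs0.le,
      intervalIntegral.integral_eq_sub_of_hasDerivAt (f := fun x => x ^ n)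
        (fun x _ => by simpa using hasDerivAt_pow n x)
        ((by fun_prop : Continuous fun x : ℝ => (n : ℝ) * x ^ (n - 1)).intervalIntegrable _ _)]
    rw [zero_pow (by omega), sub_zero]
  have h2 : ∫ x in Ioo 0 s, (α / 2 + 1) * (n * x ^ (n - 1)) ≤
      ∫ x in Ioo 0 s, (f x - u x) * x ^ n := by
    have hc : Continuous fun x : ℝ => (α / 2 + 1) * (n * x ^ (n - 1)) := by fun_prop
    have hi : IntegrableOn (fun x => (f x - u x) * x ^ n) (Ioo 0 s) := by
      have := ((memL2w_zero fun r : ℝ => r ^ n).of_sq_le (v := fun _ => 1) (C := 1)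
        aemeasurable_const (by simp)).integrableOn_mul (hf.sub hu)
      simp only [one_mul] at this
      exact this.mono_set (Ioo_subset_Ioo_right hs1.le)
    refine integral_mono_ae (hc.integrableOn_Icc.mono_set Ioo_subset_Icc_self) hi ?_
    filter_upwards [ae_restrict_mem measurableSet_Ioo,
      ae_restrict_of_ae_restrict_of_subset (Ioo_subset_Ioo_right hsε.le) hM] with x hx hMx
    have hx1 : x ≤ 1 := (hx.2.trans hs1).le
    have h3 : (α / 2 + 1) * n + |M| ≤ x * f x := hfr ⟨hx.1, hx.2.trans hsr⟩
    have h4 : x * u x ≤ |M| := by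
      have : u x ≤ |M| := (le_abs_self _).trans (hMx.trans (le_abs_self _))
      nlinarith [hx.1, abs_nonneg M]
    have h5 : x ^ n = x ^ (n - 1) * x := by rw [← pow_succ, Nat.sub_add_cancel hn]
    have h6 := pow_nonneg hx.1.le (n - 1)
    simp only [h5]
    nlinarith
  have := pow_pos hs0 n
  nlinarith

lemma ae_eq_zero_of_setIntegral_sq_mul_pow_nonpos {n : ℕ} {p : ℝ → ℝ}
    (hp : MemL2w (fun r => r ^ n) p) (h : ∫ x in Ioo (0 : ℝ) 1, p x ^ 2 * x ^ n ≤ 0) :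
    ∀ᵐ x ∂volume.restrict (Ioo (0 : ℝ) 1), p x = 0 := by
  have hnn : 0 ≤ᵐ[volume.restrict (Ioo (0 : ℝ) 1)] fun x => p x ^ 2 * x ^ n := by
    filter_upwards [ae_restrict_mem measurableSet_Ioo] with x hx
    exact mul_nonneg (sq_nonneg _) (pow_nonneg hx.1.le n)
  have h0 := (integral_eq_zero_iff_of_nonneg_ae hnn hp.2).1 (h.antisymm (integral_nonneg_of_ae hnn))
  filter_upwards [h0, ae_restrict_mem measurableSet_Ioo] with x hx hx1
  have := (pow_pos hx1.1 n).ne'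
  simpa [this] using hx

/-- The minimizer for nonnegative data is nonnegative. -/
lemma ae_nonneg_of_minimizer {n : ℕ} {f u : ℝ → ℝ} {α T : ℝ}
    (hf : MemL2w (fun r => r ^ n) f) (hu : MemL2w (fun r => r ^ n) u) (hT : TVBound n u T)
    (hmin : ∀ v S, MemL2w (fun r => r ^ n) v → TVBound n v S →
      (∫ x in Ioo (0 : ℝ) 1, (u x - f x) ^ 2 * x ^ n) + α * T ≤
        (∫ x in Ioo (0 : ℝ) 1, (v x - f x) ^ 2 * x ^ n) + α * S)
    (hf0 : ∀ r ∈ Ioo (0 : ℝ) 1, 0 ≤ f r) :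
    ∀ᵐ x ∂volume.restrict (Ioo (0 : ℝ) 1), 0 ≤ u x := by
  have hv : MemL2w (fun r => r ^ n) fun x => max (u x) 0 := by
    refine hu.of_sq_le (C := 0) (hu.1.max aemeasurable_const) fun x => ?_
    rcases le_total (u x) 0 with h | h <;> simp [h] <;> nlinarith
  have hp : MemL2w (fun r => r ^ n) fun x => max (-u x) 0 := by
    refine hu.of_sq_le (C := 0) (hu.1.neg.max aemeasurable_const) fun x => ?_
    rcases le_total (u x) 0 with h | h <;> simp [h] <;> nlinarith
  have hvT : TVBound n (fun x => max (u x) 0) T := by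
    intro z hz
    have := hT.integral_comp_add_integral_comp_le hu (F := fun s => max s 0) (G := fun _ => 0) hv
      (memL2w_zero _) (fun s t => by simpa using abs_max_sub_max_le_abs s t 0) hz (isTest_zero n)
    simpa using this
  have h := hmin _ _ hv hvT
  have h1 : ∫ x in Ioo (0 : ℝ) 1, (max (u x) 0 - f x) ^ 2 * x ^ n ≤
      ∫ x in Ioo (0 : ℝ) 1, ((u x - f x) ^ 2 * x ^ n - max (-u x) 0 ^ 2 * x ^ n) := by
    refine integral_mono_ae (hv.sub hf).2 ((hu.sub hf).2.sub hp.2) ?_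
    filter_upwards [ae_restrict_mem measurableSet_Ioo] with x hx
    have hx' := pow_nonneg hx.1.le n
    have hfx := hf0 x hx
    rw [← sub_mul]
    refine mul_le_mul_of_nonneg_right ?_ hx'
    rcases le_total (u x) 0 with h | h
    · rw [max_eq_right h, max_eq_left (by linarith)]
      nlinarith
    · rw [max_eq_left h, max_eq_right (by linarith)]
      linarith
  have h2 : ∫ x in Ioo (0 : ℝ) 1, ((u x - f x) ^ 2 * x ^ n - max (-u x) 0 ^ 2 * x ^ n) =
      (∫ x in Ioo (0 : ℝ) 1, (u x - f x) ^ 2 * x ^ n) -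
        ∫ x in Ioo (0 : ℝ) 1, max (-u x) 0 ^ 2 * x ^ n := integral_sub (hu.sub hf).2 hp.2
  filter_upwards [ae_eq_zero_of_setIntegral_sq_mul_pow_nonpos hp (by linarith)] with x hx
  have := le_max_left (-u x) 0
  linarith

/-- If `r * f r` is small near the origin then the minimizer is bounded. -/
lemma exists_ae_abs_le_of_mul_le {n : ℕ} {f u : ℝ → ℝ} {α T δ : ℝ} (hα : 0 < α)
    (hf : MemL2w (fun r => r ^ n) f) (hu : MemL2w (fun r => r ^ n) u) (hT : TVBound n u T)
    (hmin : ∀ v S, MemL2w (fun r => r ^ n) v → TVBound n v S →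
      (∫ x in Ioo (0 : ℝ) 1, (u x - f x) ^ 2 * x ^ n) + α * T ≤
        (∫ x in Ioo (0 : ℝ) 1, (v x - f x) ^ 2 * x ^ n) + α * S)
    (hf0 : ∀ r ∈ Ioo (0 : ℝ) 1, 0 ≤ f r) (hn : 1 ≤ n) (hδ : 0 < δ) (hδ1 : 2 * δ < 1)
    (hsmall : ∀ r ∈ Ioo 0 δ, r * f r ≤ α / 2 * n) :
    ∃ M, ∀ᵐ x ∂volume.restrict (Ioo (0 : ℝ) 1), |u x| ≤ M := by
  obtain ⟨M₀, hM₀⟩ := hT.exists_ae_abs_le hu (δ := δ / 2) ⟨by linarith, by linarith⟩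
  set M := max M₀ 0 with hM
  have hM0 : 0 ≤ M := le_max_right _ _
  set v : ℝ → ℝ := fun x => min (u x) M with hv
  set p : ℝ → ℝ := fun x => max (u x - M) 0 with hp
  have hp0 : ∀ x, 0 ≤ p x := fun x => le_max_right _ _
  have hvL : MemL2w (fun r => r ^ n) v := by
    refine hu.of_sq_le (C := M ^ 2) (hu.1.min aemeasurable_const) fun x => ?_
    rcases le_total (u x) M with h | h <;> simp [hv, h] <;> nlinarith
  have hpL : MemL2w (fun r => r ^ n) p := by
    refine hu.of_sq_le (C := 0) ((hu.1.sub_const M).max aemeasurable_const) fun x => ?_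
    rcases le_total (u x) M with h | h <;> simp [hp, h] <;> nlinarith
  have hpδ : ∀ᵐ x ∂volume.restrict (Ioo (0 : ℝ) 1), δ / 2 < x → p x = 0 := by
    rw [ae_restrict_iff' measurableSet_Ioo] at hM₀ ⊢
    filter_upwards [hM₀] with x hx hx1 hxδ
    have := (le_abs_self _).trans ((hx ⟨hxδ, hx1.2⟩).trans (le_max_left M₀ 0))
    exact max_eq_right (by linarith)
  have hsplit : ∀ s t : ℝ, |min s M - min t M| + |max (s - M) 0 - max (t - M) 0| ≤ |s - t| := by
    intro s t
    wlog hst : s ≤ t generalizing s t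
    · have := this t s (le_of_not_ge hst)
      rwa [abs_sub_comm (min t M), abs_sub_comm (max (t - M) 0), abs_sub_comm t] at this
    have h1 : min s M ≤ min t M := min_le_min_right _ hst
    have h2 : max (s - M) 0 ≤ max (t - M) 0 := max_le_max_right _ (by linarith)
    have h3 : ∀ s : ℝ, min s M + max (s - M) 0 = s := fun s => by
      rcases le_total s M with h | h <;> simp [h]
    rw [abs_of_nonpos (by linarith), abs_of_nonpos (by linarith), abs_of_nonpos (by linarith)]
    linarith [h3 s, h3 t]
  set χ : ℝ → ℝ → ℝ := fun ε x => Real.smoothTransition ((x - ε) / ε) with hχ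
  have hχC : ∀ ε, ContDiff ℝ 1 (χ ε) := fun ε =>
    Real.smoothTransition.contDiff.comp ((contDiff_id.sub contDiff_const).div_const ε)
  have hχ1 : ∀ ε x, χ ε x ≤ 1 := fun ε x => Real.smoothTransition.le_one _
  have hχ0 : ∀ ε x, 0 ≤ χ ε x := fun ε x => Real.smoothTransition.nonneg _
  set κ : ℝ → ℝ := fun x => Real.smoothTransition ((2 * δ - x) / δ) with hκ
  have hκC : ContDiff ℝ 1 κ :=
    Real.smoothTransition.contDiff.comp ((contDiff_const.sub contDiff_id).div_const δ)
  have hpf := hpL.integrableOn_mul hf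
  have hpfχ : ∀ ε, IntegrableOn (fun x => p x * f x * x ^ n * (1 - χ ε x)) (Ioo 0 1) := fun ε =>
    hpf.mul_bdd (c := 1) (continuous_const.sub (hχC ε).continuous).aestronglyMeasurable
      (ae_of_all _ fun x => by
        rw [Real.norm_eq_abs, abs_le]
        constructor <;> linarith [hχ0 ε x, hχ1 ε x])
  have key : ∀ ε ∈ Ioo 0 δ, ∫ x in Ioo (0 : ℝ) 1, p x ^ 2 * x ^ n ≤
      2 * ∫ x in Ioo (0 : ℝ) 1, p x * f x * x ^ n * (1 - χ ε x) := by
    rintro ε ⟨hε0, hεδ⟩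
    set z : ℝ → ℝ := fun x => x ^ n * χ ε x * κ x with hz
    have hχε : ∀ x ≤ ε, χ ε x = 0 := fun x hx =>
      Real.smoothTransition.zero_of_nonpos (div_nonpos_of_nonpos_of_nonneg (by linarith) hε0.le)
    have hκδ : ∀ x, 2 * δ ≤ x → κ x = 0 := fun x hx =>
      Real.smoothTransition.zero_of_nonpos (div_nonpos_of_nonpos_of_nonneg (by linarith) hδ.le)
    have hz0 : ∀ x ∉ Icc ε (2 * δ), z x = 0 := by
      intro x hx
      rw [mem_Icc, not_and_or, not_le, not_le] at hx
      rcases hx with hx | hx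
      · simp [hz, hχε x hx.le]
      · simp [hz, hκδ x hx.le]
    have hztest : IsTest n z := by
      refine ⟨((contDiff_id.pow n).mul (hχC ε)).mul hκC,
        HasCompactSupport.intro isCompact_Icc hz0, ?_, fun x hx => ?_⟩
      · refine (closure_minimal (fun x hx => ?_) isClosed_Icc).trans
          (Icc_subset_Ioo hε0 hδ1)
        by_contra h
        exact hx (hz0 x h)
      · have h1 := pow_nonneg hx.1.le n
        have h2 : 0 ≤ κ x := Real.smoothTransition.nonneg _
        have h3 : κ x ≤ 1 := Real.smoothTransition.le_one _
        rw [hz, abs_of_nonneg (mul_nonneg (mul_nonneg h1 (hχ0 ε x)) h2), mul_assoc]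
        exact mul_le_of_le_one_right h1 (mul_le_one₀ (hχ1 ε x) h2 h3)
    have hderiv : ∀ x ∈ Ioo 0 δ, n * x ^ (n - 1) * χ ε x ≤ deriv z x := by
      intro x hx
      have hev : z =ᶠ[𝓝 x] fun y => y ^ n * χ ε y := by
        filter_upwards [Iio_mem_nhds hx.2] with y hy
        have hy : y < δ := hy
        have : κ y = 1 := Real.smoothTransition.one_of_one_le (by
          rw [le_div_iff₀ hδ]
          linarith)
        rw [hz]
        simp [this]
      have hmono : Monotone (χ ε) := fun a b hab =>
        Real.smoothTransition.monotone (by gcongr)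
      have hd := (hasDerivAt_pow n x).mul ((hχC ε).differentiable one_ne_zero x).hasDerivAt
      have hd' : deriv (fun y => y ^ n * χ ε y) x =
        n * x ^ (n - 1) * χ ε x + x ^ n * deriv (χ ε) x := hd.deriv
      rw [hev.deriv_eq, hd']
      have := mul_nonneg (pow_nonneg hx.1.le n) (hmono.deriv_nonneg (x := x))
      linarith
    have hvT : TVBound n v (T - ∫ x in Ioo (0 : ℝ) 1, p x * deriv z x) := by
      intro z₁ hz₁
      have := hT.integral_comp_add_integral_comp_le hu hvL hpL hsplit hz₁ hztest
      exact le_sub_iff_add_le.2 this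
    have h := hmin _ _ hvL hvT
    have i1 : IntegrableOn (fun x => (u x - f x) ^ 2 * x ^ n) (Ioo 0 1) := (hu.sub hf).2
    have i2 : IntegrableOn (fun x => α * (p x * deriv z x)) (Ioo 0 1) :=
      (hpL.integrableOn_mul_deriv hztest).const_mul α
    have i3 : IntegrableOn (fun x => (v x - f x) ^ 2 * x ^ n) (Ioo 0 1) := (hvL.sub hf).2
    have i4 : IntegrableOn (fun x => p x ^ 2 * x ^ n) (Ioo 0 1) := hpL.2
    have i5 : IntegrableOn (fun x => 2 * (p x * f x * x ^ n * (1 - χ ε x))) (Ioo 0 1) :=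
      (hpfχ ε).const_mul 2
    have i14 : IntegrableOn (fun x => (u x - f x) ^ 2 * x ^ n - p x ^ 2 * x ^ n) (Ioo 0 1) :=
      i1.sub i4
    have i145 : IntegrableOn (fun x => (u x - f x) ^ 2 * x ^ n - p x ^ 2 * x ^ n +
      2 * (p x * f x * x ^ n * (1 - χ ε x))) (Ioo 0 1) := i14.add i5
    have i1452 : IntegrableOn (fun x => (u x - f x) ^ 2 * x ^ n - p x ^ 2 * x ^ n +
      2 * (p x * f x * x ^ n * (1 - χ ε x)) + α * (p x * deriv z x)) (Ioo 0 1) := i145.add i2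
    have hle : ∫ x in Ioo (0 : ℝ) 1, (v x - f x) ^ 2 * x ^ n ≤
        ∫ x in Ioo (0 : ℝ) 1, ((u x - f x) ^ 2 * x ^ n - p x ^ 2 * x ^ n +
          2 * (p x * f x * x ^ n * (1 - χ ε x)) + α * (p x * deriv z x)) := by
      refine integral_mono_ae i3 i1452 ?_
      filter_upwards [hpδ, ae_restrict_mem measurableSet_Ioo] with x hpx hx
      have hxn := pow_nonneg hx.1.le n
      have hquad : (v x - f x) ^ 2 ≤ (u x - f x) ^ 2 - p x ^ 2 + 2 * (p x * f x) := by
        rcases le_total (u x) M with h | h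
        · simp [hv, hp, h]
        · simp only [hv, hp, min_eq_right h, max_eq_left (sub_nonneg.2 h)]
          nlinarith
      have hquad' := mul_le_mul_of_nonneg_right hquad hxn
      have hcurv : 2 * (p x * f x * x ^ n * χ ε x) ≤ α * (p x * deriv z x) := by
        rcases le_or_gt x (δ / 2) with hxδ | hxδ
        · have hxδ' : x ∈ Ioo 0 δ := ⟨hx.1, by linarith⟩
          have h1 := mul_le_mul_of_nonneg_left (hderiv x hxδ') (hp0 x)
          have h2 := mul_le_mul_of_nonneg_right (hsmall x hxδ')
            (mul_nonneg (mul_nonneg (pow_nonneg hx.1.le (n - 1)) (hp0 x)) (hχ0 ε x))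
          have h3 : x ^ n = x ^ (n - 1) * x := by rw [← pow_succ, Nat.sub_add_cancel hn]
          rw [h3]
          have h4 := mul_le_mul_of_nonneg_left h1 hα.le
          linarith
        · simp [hpx hxδ]
      linarith
    have e1 := integral_add i145 i2
    have e2 := integral_add i14 i5
    have e3 := integral_sub i1 i4
    rw [integral_const_mul] at e1 e2
    linarith
  have hlim : Tendsto (fun ε => 2 * ∫ x in Ioo (0 : ℝ) 1, p x * f x * x ^ n * (1 - χ ε x))
      (𝓝[>] 0) (𝓝 (2 * ∫ _ in Ioo (0 : ℝ) 1, (0 : ℝ))) := by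
    refine Tendsto.const_mul 2 (tendsto_integral_filter_of_dominated_convergence
      (fun x => ‖p x * f x * x ^ n‖) (Eventually.of_forall fun ε => (hpfχ ε).1)
      (Eventually.of_forall fun ε => ae_of_all _ fun x => ?_) hpf.norm ?_)
    · rw [norm_mul]
      refine mul_le_of_le_one_right (norm_nonneg _) ?_
      rw [Real.norm_eq_abs, abs_le]
      constructor <;> linarith [hχ0 ε x, hχ1 ε x]
    · filter_upwards [ae_restrict_mem measurableSet_Ioo] with x hx
      refine tendsto_const_nhds.congr' ?_
      filter_upwards [Ioo_mem_nhdsGT (half_pos hx.1)] with ε hε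
      have : χ ε x = 1 := Real.smoothTransition.one_of_one_le (by
        rw [le_div_iff₀ hε.1]
        linarith [hε.2])
      simp [this]
  rw [integral_zero, mul_zero] at hlim
  have hle := ge_of_tendsto hlim (by
    filter_upwards [Ioo_mem_nhdsGT hδ] with ε hε using key ε hε)
  refine ⟨M, ?_⟩
  filter_upwards [ae_eq_zero_of_setIntegral_sq_mul_pow_nonpos hpL hle,
    ae_nonneg_of_minimizer hf hu hT hmin hf0] with x hx hux
  rw [abs_of_nonneg hux]
  have := le_max_left (u x - M) 0
  linarith

/-- Proposition `generalradial`.  Let `f ≥ 0` be radial data in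
`L²_{r^{d−1}}(0,1)` and `u` the minimizer of the weighted ROF problem with weights
`ρ(r) = φ(r) = r^{d−1}`.  If `r^β f(r) → +∞` as `r → 0` for some `β > 1`, then `u` is
unbounded on every neighborhood of `0` but bounded on every compact interval excluding
zero; conversely, if `r^β f(r) → 0` for some `β < 1`, then `u` is bounded. -/
theorem statement_14
    (d : ℕ) (hd : 2 ≤ d) (α : ℝ) (hα : 0 < α)
    (φ : ℝ → ℝ) (hφ : ∀ r : ℝ, φ r = r ^ ((d : ℝ) - 1))
    (f : ℝ → ℝ) (hf0 : ∀ r ∈ Set.Ioo (0:ℝ) 1, 0 ≤ f r) (hfL2 : MemL2w φ f)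
    (u : ℝ → ℝ) (hu : IsEROFMinimizer φ φ f α u) :
    (∀ β : ℝ, 1 < β →
      Tendsto (fun r : ℝ => r ^ β * f r) (nhdsWithin 0 (Set.Ioi 0)) atTop →
      (∀ ε ∈ Set.Ioo (0:ℝ) 1, eLpNorm u ⊤ (volume.restrict (Set.Ioo (0:ℝ) ε)) = ⊤) ∧
      (∀ δ ∈ Set.Ioo (0:ℝ) 1, eLpNorm u ⊤ (volume.restrict (Set.Ioo δ 1)) < ⊤)) ∧
    (∀ β : ℝ, β < 1 →
      Tendsto (fun r : ℝ => r ^ β * f r) (nhdsWithin 0 (Set.Ioi 0)) (𝓝 0) →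
      eLpNorm u ⊤ (volume.restrict (Set.Ioo (0:ℝ) 1)) < ⊤) := by
  obtain ⟨n, rfl⟩ : ∃ n : ℕ, d = n + 1 := ⟨d - 1, by omega⟩
  have hn : 1 ≤ n := by omega
  obtain rfl : φ = fun r => r ^ n := by
    ext r
    rw [hφ, Nat.cast_add, Nat.cast_one, add_sub_cancel_right, Real.rpow_natCast]
  obtain ⟨T, hT, hmin⟩ := hu.exists_real hα
  have hrpow : ∀ (β r : ℝ), 0 < r → r = r ^ (1 - β) * r ^ β := fun β r hr => by
    rw [← Real.rpow_add hr, sub_add_cancel, Real.rpow_one]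
  refine ⟨fun β hβ hlim => ⟨fun ε hε => ?_, fun δ hδ => ?_⟩, fun β hβ hlim => ?_⟩
  · refine eLpNorm_top_eq_top_of_tendsto hn hfL2 hu.1 hT hmin ?_ hε.1
    refine tendsto_atTop_mono' _ ?_ hlim
    filter_upwards [Ioo_mem_nhdsGT zero_lt_one] with r hr
    refine mul_le_mul_of_nonneg_right ?_ (hf0 r hr)
    nth_rewrite 2 [hrpow β r hr.1]
    exact le_mul_of_one_le_left (Real.rpow_nonneg hr.1.le _)
      (Real.one_le_rpow_of_pos_of_le_one_of_nonpos hr.1 hr.2.le (by linarith))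
  · exact eLpNorm_top_lt_top_iff_exists_ae_abs_le.2 (hT.exists_ae_abs_le hu.1 hδ)
  · have hc : 0 < α / 2 * (n : ℝ) := by positivity
    obtain ⟨s, hs0, hs⟩ := mem_nhdsGT_iff_exists_Ioo_subset.1 (hlim.eventually_le_const hc)
    have hs0 : 0 < s := hs0
    obtain ⟨δ, hδ0, hδ⟩ := exists_between (show 0 < min s (1 / 2) by positivity)
    obtain ⟨hδs, hδ1⟩ := lt_min_iff.1 hδ
    refine eLpNorm_top_lt_top_iff_exists_ae_abs_le.2 (exists_ae_abs_le_of_mul_le hα hfL2 hu.1 hT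
      hmin hf0 hn hδ0 (by linarith) fun r hr => ?_)
    refine le_trans (mul_le_mul_of_nonneg_right ?_ (hf0 r ⟨hr.1, by linarith [hr.2]⟩))
      (hs ⟨hr.1, hr.2.trans hδs⟩)
    nth_rewrite 1 [hrpow β r hr.1]
    exact mul_le_of_le_one_left (Real.rpow_nonneg hr.1.le _)
      (Real.rpow_le_one hr.1.le (by linarith [hr.2]) (by linarith))
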